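/- arXiv:1305.6146 — 6 statements merged into one kernel-verified Lean document; each statement's English description precedes it below -/
import Mathlib

section
/- Let p be a prime and G a commutative group in which every element x satisfies x^p = 1. Let h ∈ G, let f be a polynomial over ZMod p, and let S be a finite set of elements of ZMod p with 0 ∉ S and deg f < |S|. Define F_i = h^((f(i)).val) for i ∈ S. Then ∏_{i ∈ S} F_i^((Δ_{i,S}(0)).val) = h^((f(0)).val), where Δ_{i,S}(0) = ∏_{j ∈ S, j ≠ i} (0 − j)/(i − j) is computed in the field ZMod p. (Correctness of the Transform recursion of proxy ABE at a threshold gate: combining the partial transforms F_z = e(g,g)^{s·q_z(0)/z_u} of the children via Lagrange coefficients yields e(g,g)^{s·q_x(0)/z_u}.) -/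
/-- The Lagrange interpolation formula, evaluated at an arbitrary point. -/
theorem sum_eval_mul_lagrange_coeff {F : Type*} [Field F] [DecidableEq F] (f : Polynomial F)
    (S : Finset F) (hdeg : f.degree < (S.card : WithBot ℕ)) (x : F) :
    ∑ i ∈ S, f.eval i * ∏ j ∈ S.erase i, (x - j) / (i - j) = f.eval x := by
  conv_rhs => rw [Lagrange.eq_interpolate (v := id) Function.injective_id.injOn hdeg]
  simp [Lagrange.interpolate_apply, Polynomial.eval_finsetSum, Lagrange.basis,
    Polynomial.eval_prod, Lagrange.basisDivisor, div_eq_inv_mul]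

/-- Correctness of the Transform recursion of proxy ABE at a threshold gate:
combining the partial transforms `F_i = h^{f(i)}` of the children via Lagrange
coefficients yields `h^{f(0)}`. -/
theorem transform_threshold_gate (p : ℕ) [Fact p.Prime] (G : Type*) [CommGroup G]
    (hG : ∀ x : G, x ^ p = 1) (h : G) (f : Polynomial (ZMod p))
    (S : Finset (ZMod p)) (h0 : (0 : ZMod p) ∉ S) (hdeg : f.degree < (S.card : WithBot ℕ)) :
    ∏ i ∈ S, (h ^ (f.eval i).val) ^ ((∏ j ∈ S.erase i, (0 - j) / (i - j) : ZMod p)).val =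
      h ^ (f.eval 0).val := by
  simp_rw [← pow_mul, Finset.prod_pow_eq_pow_sum]
  refine pow_eq_pow_of_modEq ((ZMod.natCast_eq_natCast_iff _ _ p).mp ?_) (hG h)
  simpa using sum_eval_mul_lagrange_coeff f S hdeg 0
end

section
/- Let p be a prime and G a commutative group in which every element x satisfies x^p = 1. Let w, m ∈ G and y, s, z ∈ ZMod p with z ≠ 0. Set U = m · w^((y·s).val) and V = w^((y·s·z⁻¹).val). Then U · (V^(z.val))⁻¹ = m. (Correctness of the final decryption of proxy ABE: given the transformed ciphertext CT' = (U,V) = (m·e(g,g)^{y·s}, e(g,g)^{y·s/z_u}), the user recovers m = U / V^{z_u}.) -/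
/-- If `x ^ p = 1`, iterated powers by canonical representatives multiply
the exponents in `ZMod p`. -/
theorem pow_val_mul_of_pow_eq_one {M : Type*} [Monoid M] {p : ℕ} {x : M} (hx : x ^ p = 1)
    (a b : ZMod p) : (x ^ a.val) ^ b.val = x ^ (a * b).val := by
  rw [← pow_mul, ZMod.val_mul, ← pow_eq_pow_mod _ hx]

/-- Correctness of the final decryption of proxy ABE: given the transformed
ciphertext `CT' = (U,V) = (m·e(g,g)^{y·s}, e(g,g)^{y·s/z_u})`, the user recovers
`m = U / V^{z_u}`. -/
theorem proxy_abe_final_decryption (p : ℕ) (hp : p.Prime) (G : Type*) [CommGroup G]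
    (hG : ∀ x : G, x ^ p = 1) (w m : G) (y s z : ZMod p) (hz : z ≠ 0)
    (U : G) (hU : U = m * w ^ ((y * s).val))
    (V : G) (hV : V = w ^ ((y * s * z⁻¹).val)) :
    U * (V ^ z.val)⁻¹ = m := by
  have : Fact p.Prime := ⟨hp⟩
  rw [hU, hV, pow_val_mul_of_pow_eq_one (hG w), inv_mul_cancel_right₀ hz, mul_inv_cancel_right]
end

section
/- Let p be a prime, G a commutative group, g ∈ G with g^p = 1, and ws ≥ 1. Let M, r : ℕ → ZMod p and SK ∈ ZMod p be such that s(r, ws)[i] = SK for all i. Define the ciphertext CT(j) = g^((M j + r j).val). Then for every i, ∏_{t=0}^{ws−1} CT(i·ws + t) = g^(SK.val) · g^((s(M, ws)[i]).val). (Correctness of decryption in the sliding-window construction E_w^1: the product of the ciphertexts over the i-th window, divided by g^{SK_{ws}}, equals g raised to the i-th window sum of M, so taking the discrete logarithm recovers s(M,ws)[i].) -/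
/-- The `i`-th window sum of `M` with window size `w` (sliding window with
advance step equal to the window size): `s(M,w)[i] = ∑_{t<w} M (i·w + t)`. -/
def windowSum {A : Type*} [AddCommMonoid A] (M : ℕ → A) (w i : ℕ) : A :=
  ∑ t ∈ Finset.range w, M (i * w + t)

theorem windowSum_add {A : Type*} [AddCommMonoid A] (M N : ℕ → A) (w i : ℕ) :
    windowSum (fun j => M j + N j) w i = windowSum M w i + windowSum N w i :=
  Finset.sum_add_distrib

section PowVal

variable {n : ℕ} [NeZero n] {G : Type*}

theorem pow_val_add [Monoid G] {g : G} (hg : g ^ n = 1) (a b : ZMod n) :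
    g ^ (a + b).val = g ^ a.val * g ^ b.val := by
  rw [ZMod.val_add, ← pow_eq_pow_mod _ hg, pow_add]

theorem prod_pow_val [CommMonoid G] {g : G} (hg : g ^ n = 1) {ι : Type*} (s : Finset ι)
    (f : ι → ZMod n) : ∏ t ∈ s, g ^ (f t).val = g ^ (∑ t ∈ s, f t).val := by
  classical
  induction s using Finset.induction_on with
  | empty => simp
  | insert a s ha ih => rw [Finset.prod_insert ha, Finset.sum_insert ha, pow_val_add hg, ih]

end PowVal

/-- Correctness of decryption in the sliding-window construction `E_w^1`:
the product of the ciphertexts over the `i`-th window equals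
`g^{SK} · g^{s(M,ws)[i]}`. -/
theorem swe1_decryption_correct (p : ℕ) (hp : p.Prime) (G : Type*) [CommGroup G]
    (g : G) (hg : g ^ p = 1) (ws : ℕ) (hws : 1 ≤ ws)
    (M r : ℕ → ZMod p) (SK : ZMod p) (hr : ∀ i : ℕ, windowSum r ws i = SK)
    (CT : ℕ → G) (hCT : ∀ j : ℕ, CT j = g ^ ((M j + r j).val)) :
    ∀ i : ℕ, ∏ t ∈ Finset.range ws, CT (i * ws + t) =
      g ^ SK.val * g ^ ((windowSum M ws i).val) := by
  intro i
  have : NeZero p := ⟨hp.ne_zero⟩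
  simp only [hCT]
  rw [prod_pow_val hg, ← pow_val_add hg, ← hr i, add_comm (windowSum r ws i), ← windowSum_add]
  rfl
end

section
/- Let p be a prime, k ≥ 1, ws ≥ 1, n = k·ws, and SK ∈ ZMod p. Let C ⊆ (Fin n → ZMod p) be the (finite) set of r with ∑_{t=0}^{ws−1} r(i·ws + t) = SK for all i < k. Then C is nonempty, and for any M₀, M₁ : Fin n → ZMod p whose window sums agree (∑_{t<ws} M₀(i·ws+t) = ∑_{t<ws} M₁(i·ws+t) for all i < k), the pushforward of the uniform probability mass function on C under r ↦ M₀ + r equals its pushforward under r ↦ M₁ + r: PMF.map (fun r => M₀ + r) (PMF.uniformOfFinset C) = PMF.map (fun r => M₁ + r) (PMF.uniformOfFinset C). (Perfect secrecy of the masked values in E_w^1: the distribution of the masked sequence reveals nothing about the messages beyond their window sums.) -/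
/-- The index `i·ws + t` of the `t`-th element of the `i`-th window, as an
element of `Fin (k·ws)`. -/
def winIdx {k ws : ℕ} (i : ℕ) (hi : i < k) (t : Fin ws) : Fin (k * ws) :=
  ⟨i * ws + t.val, by
    have h1 : i * ws + ws ≤ k * ws := by
      calc i * ws + ws = (i + 1) * ws := by ring
        _ ≤ k * ws := Nat.mul_le_mul_right ws hi
    have h2 := t.isLt
    omega⟩

theorem PMF.map_add_left_apply {G : Type*} [AddCommGroup G] (P : PMF G) (a y : G) :
    PMF.map (fun r => a + r) P y = P (y - a) := by
  classical
  rw [PMF.map_apply, tsum_eq_single (y - a)]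
  · simp
  · intro r hr
    rw [if_neg]
    rintro rfl
    simp at hr

theorem sum_window_indicator {R : Type*} [AddCommMonoid R] {k ws : ℕ} (hws : 1 ≤ ws)
    (s : R) (i : ℕ) (hi : i < k) :
    ∑ t : Fin ws, (if (winIdx i hi t).val % ws = 0 then s else 0) = s := by
  rw [Finset.sum_eq_single (⟨0, hws⟩ : Fin ws)]
  · simp [winIdx]
  · intro t _ ht
    rw [if_neg]
    intro h
    apply ht
    ext
    simpa [winIdx, Nat.mod_eq_of_lt t.isLt] using h
  · simp

/-- Perfect secrecy of the masked values in `E_w^1`: the set `C` of admissible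
masking vectors is nonempty, and for challenge messages with equal window sums,
the distribution of the masked sequence `M + r` for `r` uniform on `C` is the
same for `M₀` and `M₁`. -/
theorem swe1_perfect_secrecy (p : ℕ) (hp : p.Prime) (k ws : ℕ) (hk : 1 ≤ k)
    (hws : 1 ≤ ws) (SK : ZMod p)
    (C : Finset (Fin (k * ws) → ZMod p))
    (hC : ∀ r, r ∈ C ↔ ∀ i (hi : i < k), ∑ t : Fin ws, r (winIdx i hi t) = SK)
    (M₀ M₁ : Fin (k * ws) → ZMod p)
    (hM : ∀ i (hi : i < k),
      ∑ t : Fin ws, M₀ (winIdx i hi t) = ∑ t : Fin ws, M₁ (winIdx i hi t)) :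
    ∃ h : C.Nonempty,
      PMF.map (fun r => M₀ + r) (PMF.uniformOfFinset C h) =
        PMF.map (fun r => M₁ + r) (PMF.uniformOfFinset C h) := by
  have hne : C.Nonempty :=
    ⟨fun j => if j.val % ws = 0 then SK else 0,
      (hC _).2 fun i hi => sum_window_indicator hws SK i hi⟩
  refine ⟨hne, ?_⟩
  ext y
  have hmem : y - M₀ ∈ C ↔ y - M₁ ∈ C := by
    simp only [hC, Pi.sub_apply, Finset.sum_sub_distrib]
    exact forall₂_congr fun i hi => by rw [hM i hi]
  rw [PMF.map_add_left_apply, PMF.map_add_left_apply, PMF.uniformOfFinset_apply,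
    PMF.uniformOfFinset_apply]
  split_ifs <;> tauto
end

section
/- Let p be a prime, G a commutative group, g ∈ G with g^p = 1, and ws ≥ 1. Let m, r : ℕ → ZMod p and s* ∈ ZMod p, and define the cumulative value Z(t) = s* + ∑_{j=0}^{t−1} r j. Then for every i: (1) g^((Z((i+1)·ws)).val) · (g^((Z(i·ws)).val))⁻¹ = g^((s(r, ws)[i]).val), and (2) letting U' = ∏_{t=0}^{ws−1} g^((m(i·ws+t) + r(i·ws+t)).val) and V' = g^((Z((i+1)·ws)).val) · (g^((Z(i·ws)).val))⁻¹, one has U' · (V')⁻¹ = g^((s(m, ws)[i]).val). (Correctness of the cloud's aggregation protocol Agg-3 based on E_w^3: dividing the product of the window's masked ciphertexts by the telescoped quotient of cumulative mask values yields g raised to the window sum of the plaintexts, whose discrete logarithm the user extracts.) -/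
/-- If `g ^ n = 1`, raising `g` to canonical representatives turns sums in `ZMod n` into products. -/
theorem pow_zmod_val_add {M : Type*} [Monoid M] {n : ℕ} [NeZero n] {g : M} (hg : g ^ n = 1)
    (a b : ZMod n) : g ^ (a + b).val = g ^ a.val * g ^ b.val := by
  rw [ZMod.val_add, ← pow_eq_pow_mod _ hg, pow_add]

theorem pow_zmod_val_sum {ι M : Type*} [CommMonoid M] {n : ℕ} [NeZero n] {g : M}
    (hg : g ^ n = 1) (s : Finset ι) (f : ι → ZMod n) :
    g ^ (∑ j ∈ s, f j).val = ∏ j ∈ s, g ^ (f j).val := by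
  classical
  induction s using Finset.induction_on with
  | empty => simp
  | insert a s ha ih => rw [Finset.sum_insert ha, Finset.prod_insert ha, pow_zmod_val_add hg, ih]

/-- Window sums are the increments of the partial sums. -/
theorem sum_range_succ_mul_eq_add_windowSum {A : Type*} [AddCommMonoid A] (M : ℕ → A) (w i : ℕ) :
    ∑ j ∈ Finset.range ((i + 1) * w), M j =
      ∑ j ∈ Finset.range (i * w), M j + windowSum M w i := by
  rw [add_one_mul, Finset.sum_range_add, windowSum]

/-- Correctness of the cloud's aggregation protocol Agg-3 based on `E_w^3`:
with cumulative mask values `Z(t) = s* + ∑_{j<t} r j`, (1) the telescoped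
quotient of the cumulative values over the `i`-th window equals `g` raised to
the window sum of the masks, and (2) dividing the product of the window's masked
ciphertexts by this quotient yields `g` raised to the window sum of the
plaintexts. -/
theorem agg3_correct (p : ℕ) (hp : p.Prime) (G : Type*) [CommGroup G] (g : G)
    (hg : g ^ p = 1) (ws : ℕ) (hws : 1 ≤ ws) (m r : ℕ → ZMod p) (sStar : ZMod p)
    (Z : ℕ → ZMod p) (hZ : ∀ t : ℕ, Z t = sStar + ∑ j ∈ Finset.range t, r j) :
    ∀ i : ℕ,
      g ^ ((Z ((i + 1) * ws)).val) * (g ^ ((Z (i * ws)).val))⁻¹ =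
        g ^ ((windowSum r ws i).val) ∧
      (∏ t ∈ Finset.range ws, g ^ ((m (i * ws + t) + r (i * ws + t)).val)) *
          (g ^ ((Z ((i + 1) * ws)).val) * (g ^ ((Z (i * ws)).val))⁻¹)⁻¹ =
        g ^ ((windowSum m ws i).val) := by
  have : NeZero p := ⟨hp.ne_zero⟩
  intro i
  have hquot : g ^ (Z ((i + 1) * ws)).val * (g ^ (Z (i * ws)).val)⁻¹ =
      g ^ (windowSum r ws i).val := by
    rw [hZ ((i + 1) * ws), sum_range_succ_mul_eq_add_windowSum, ← add_assoc, ← hZ,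
      pow_zmod_val_add hg, mul_inv_cancel_comm]
  refine ⟨hquot, ?_⟩
  rw [hquot, ← pow_zmod_val_sum hg, Finset.sum_add_distrib, pow_zmod_val_add hg]
  exact mul_inv_cancel_right _ _
end

section
/- Let p be a prime, ws ≥ 1, and W a finite set of positive integers such that ws ∣ w for every w ∈ W. Let SK : W → ZMod p assign a key to each window size, and let r : W → (ℕ → ZMod p) be a family of masking sequences with s(r w, w)[i] = SK w for all w ∈ W and all i. Let M₀, M₁ : ℕ → ZMod p satisfy s(M₀, ws)[i] = s(M₁, ws)[i] for all i. Then the shifted family r' w := r w + M₀ − M₁ (pointwise) again satisfies s(r' w, w)[i] = SK w for all w ∈ W and all i, and for every w ∈ W the masked sequences coincide: M₀ + r w = M₁ + r' w pointwise. (Multi-window core of the Res-CEW security proof of E_w^1: when the adversary corrupts keys for window sizes w with gcd(ws, w) = ws, every family of admissible masks for M₀ corresponds to a family of admissible masks for M₁ producing identical ciphertexts for all corrupted window sizes.) -/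
/-- A window sum of size `d * k` is the sum of `k` consecutive window sums of size `d`. -/
theorem windowSum_mul {A : Type*} [AddCommMonoid A] (M : ℕ → A) (d k i : ℕ) :
    windowSum M (d * k) i = ∑ j ∈ Finset.range k, windowSum M d (i * k + j) := by
  have block (f : ℕ → A) : ∑ t ∈ Finset.range (d * k), f t =
      ∑ j ∈ Finset.range k, ∑ t ∈ Finset.range d, f (j * d + t) := by
    induction k with
    | zero => simp
    | succ k ih => rw [Nat.mul_succ, Finset.sum_range_add, ih, Finset.sum_range_succ, mul_comm d k]
  unfold windowSum
  rw [block]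
  refine Finset.sum_congr rfl fun j _ => Finset.sum_congr rfl fun t _ => congrArg M ?_
  ring

/-- Sequences with equal window sums of size `d` have equal window sums of every multiple of `d`. -/
theorem windowSum_eq_of_dvd {A : Type*} [AddCommMonoid A] {M N : ℕ → A} {d w : ℕ}
    (hdw : d ∣ w) (h : ∀ i, windowSum M d i = windowSum N d i) (i : ℕ) :
    windowSum M w i = windowSum N w i := by
  obtain ⟨k, rfl⟩ := hdw
  simp only [windowSum_mul, h]

/-- Multi-window core of the Res-CEW security proof of `E_w^1`: if every window
size `w ∈ W` is a multiple of `ws` and the masking sequences `r w` are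
admissible for the keys `SK w`, then for challenge messages `M₀, M₁` with equal
window sums at size `ws`, the shifted masks `r' w = r w + M₀ − M₁` are again
admissible for the same keys, and produce identical masked sequences:
`M₀ + r w = M₁ + r' w`. -/
theorem swe1_multi_window_shift (p : ℕ) (hp : p.Prime) (ws : ℕ) (hws : 1 ≤ ws)
    (W : Finset ℕ) (hWpos : ∀ w ∈ W, 0 < w) (hWdvd : ∀ w ∈ W, ws ∣ w)
    (SK : ℕ → ZMod p) (r : ℕ → ℕ → ZMod p)
    (hr : ∀ w ∈ W, ∀ i : ℕ, windowSum (r w) w i = SK w)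
    (M₀ M₁ : ℕ → ZMod p)
    (hM : ∀ i : ℕ, windowSum M₀ ws i = windowSum M₁ ws i)
    (r' : ℕ → ℕ → ZMod p) (hr' : ∀ w j : ℕ, r' w j = r w j + M₀ j - M₁ j) :
    (∀ w ∈ W, ∀ i : ℕ, windowSum (r' w) w i = SK w) ∧
      (∀ w ∈ W, ∀ j : ℕ, M₀ j + r w j = M₁ j + r' w j) := by
  refine ⟨fun w hw i => ?_, fun w _ j => by rw [hr']; ring⟩
  have hwin : windowSum (r' w) w i = windowSum (r w) w i + windowSum M₀ w i - windowSum M₁ w i := by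
    simp only [windowSum, hr', Finset.sum_sub_distrib, Finset.sum_add_distrib]
  rw [hwin, windowSum_eq_of_dvd (hWdvd w hw) hM, add_sub_cancel_right, hr w hw]
end
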